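/- Uniform Covering Lemma: Let G be a connected simple graph with n ≥ 2 vertices, let r be a vertex of G, and let 𝒯 be a finite set of strategies rooted at r. If there is a rational m > 0 such that ∑_{(T,w) ∈ 𝒯} w(v) = m for every vertex v ≠ r, then π(G,r) = n. -/

import Mathlib

open Finset SimpleGraph

variable {V : Type*}

/-- A single pebbling move: remove two pebbles from `u` and add one pebble to a
neighbor `v`. -/
def PebblingMove (G : SimpleGraph V) (C C' : V → ℕ) : Prop :=
  ∃ u v : V, G.Adj u v ∧ 2 ≤ C u ∧
    C' u = C u - 2 ∧ C' v = C v + 1 ∧ ∀ x : V, x ≠ u → x ≠ v → C' x = C x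

/-- A configuration `C` is `r`-solvable if some finite sequence of pebbling moves
starting from `C` yields a configuration with at least one pebble on `r`. -/
def PebblingSolvable (G : SimpleGraph V) (r : V) (C : V → ℕ) : Prop :=
  ∃ C' : V → ℕ, Relation.ReflTransGen (PebblingMove G) C C' ∧ 1 ≤ C' r

/-- `piVertex G r` is the least `t` such that every configuration of size `t`
is `r`-solvable. -/
noncomputable def piVertex [Fintype V] (G : SimpleGraph V) (r : V) : ℕ :=
  sInf {t : ℕ | ∀ C : V → ℕ, (∑ v, C v) = t → PebblingSolvable G r C}

/-- The pebbling number `π(G) = max_r π(G,r)`. -/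
noncomputable def pebblingNumber [Fintype V] (G : SimpleGraph V) : ℕ :=
  Finset.univ.sup (fun r => piVertex G r)

/-- A (basic) strategy rooted at `r`: a subtree `T` of `G` containing `r` with
at least two vertices, together with a nonnegative, nonzero weight function `w`
vanishing off `T` and at `r`, with `w(v⁺) = 2·w(v)` for every vertex `v` of `T`
other than `r` and the children of `r`, where `v⁺` is the parent of `v`, i.e.
the neighbor of `v` on the path in `T` from `v` to `r`. -/
structure Strategy (G : SimpleGraph V) (r : V) where
  T : G.Subgraph
  w : V → ℚ
  root_mem : r ∈ T.verts
  two_le_ncard : 2 ≤ T.verts.ncard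
  isTree : T.coe.IsTree
  w_nonneg : ∀ v, 0 ≤ w v
  w_ne_zero : w ≠ 0
  w_outside : ∀ v, v ∉ T.verts → w v = 0
  w_root : w r = 0
  w_parent : ∀ u v : T.verts, T.coe.Adj u v → (v : V) ≠ r → ¬ T.Adj r (v : V) →
    T.coe.dist u ⟨r, root_mem⟩ < T.coe.dist v ⟨r, root_mem⟩ → w (u : V) = 2 * w (v : V)

/-- `w(C) = ∑_{v ∈ V(G)} w(v)·C(v)`. -/
noncomputable def configWeight [Fintype V] {G : SimpleGraph V} {r : V}
    (S : Strategy G r) (C : V → ℕ) : ℚ :=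
  ∑ v, S.w v * (C v : ℚ)

open Classical in
/-- `w(𝐓) = ∑_{v ∈ V(T), v ≠ r} w(v)`. -/
noncomputable def treeWeight [Fintype V] {G : SimpleGraph V} {r : V} (S : Strategy G r) : ℚ :=
  ∑ v ∈ Finset.univ.filter (fun v => v ∈ S.T.verts ∧ v ≠ r), S.w v

/-- A vertex carrying nonzero weight in a strategy is adjacent to the root or to a vertex of
twice its weight. -/
theorem Strategy.adj_root_or_exists_adj_two_mul {G : SimpleGraph V} {r : V} (S : Strategy G r)
    {v : V} (hv : S.w v ≠ 0) : G.Adj v r ∨ ∃ u, G.Adj v u ∧ S.w u = 2 * S.w v := by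
  have hvT : v ∈ S.T.verts := by
    by_contra hn
    exact hv (S.w_outside v hn)
  have hvr : v ≠ r := by
    rintro rfl
    exact hv S.w_root
  by_cases hadj : S.T.Adj r v
  · exact Or.inl hadj.adj_sub.symm
  · right
    obtain ⟨p, hp⟩ :=
      S.isTree.connected.exists_walk_length_eq_dist (⟨v, hvT⟩ : S.T.verts) ⟨r, S.root_mem⟩
    cases p with
    | nil => exact absurd rfl hvr
    | @cons _ u _ huv q =>
      refine ⟨u, Subgraph.Adj.adj_sub huv, S.w_parent u ⟨v, hvT⟩ huv.symm hvr hadj ?_⟩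
      have hq := dist_le q
      rw [Walk.length_cons] at hp
      omega

theorem PebblingSolvable.of_move {G : SimpleGraph V} {r : V} {C C' : V → ℕ}
    (hC : PebblingMove G C C') (h : PebblingSolvable G r C') : PebblingSolvable G r C := by
  obtain ⟨D, hD, hr⟩ := h
  exact ⟨D, .head hC hD, hr⟩

open Classical in
/-- The configuration obtained from `C` by a pebbling move from `u` to `v`. -/
noncomputable def pebble (C : V → ℕ) (u v : V) : V → ℕ :=
  Function.update (Function.update C u (C u - 2)) v (C v + 1)

theorem pebblingMove_pebble {G : SimpleGraph V} {C : V → ℕ} {u v : V} (huv : G.Adj u v)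
    (hu : 2 ≤ C u) : PebblingMove G C (pebble C u v) := by
  refine ⟨u, v, huv, hu, ?_, ?_, fun x hxu hxv => ?_⟩
  · simp [pebble, huv.ne]
  · simp [pebble]
  · simp [pebble, hxu, hxv]

theorem sum_mul_pebble [Fintype V] (w : V → ℚ) {C : V → ℕ} {u v : V} (huv : u ≠ v)
    (hu : 2 ≤ C u) :
    ∑ x, w x * (pebble C u v x : ℚ) = ∑ x, w x * (C x : ℚ) - 2 * w u + w v := by
  classical
  have key : ∀ x, w x * (pebble C u v x : ℚ) =
      w x * (C x : ℚ) - (if x = u then 2 * w u else 0) + (if x = v then w v else 0) := by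
    intro x
    by_cases hxv : x = v
    · subst hxv
      simp [pebble, huv.symm]
      ring
    · by_cases hxu : x = u
      · subst hxu
        simp [pebble, hxv, Nat.cast_sub hu]
        ring
      · simp [pebble, hxv, hxu]
  simp only [key, sum_add_distrib, sum_sub_distrib, sum_ite_eq', mem_univ, if_true]

/-- **Weight Function Lemma.** A configuration whose weight exceeds the total weight of a
strategy is solvable. -/
theorem Strategy.pebblingSolvable_of_sum_lt [Fintype V] {G : SimpleGraph V} {r : V}
    (S : Strategy G r) (C : V → ℕ) (hC : ∑ v, S.w v < configWeight S C) :
    PebblingSolvable G r C := by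
  induction hn : ∑ v, C v using Nat.strong_induction_on generalizing C with
  | _ n ih =>
    obtain ⟨v, -, hv⟩ := exists_lt_of_sum_lt hC
    have hw : 0 < S.w v := by
      refine (S.w_nonneg v).lt_of_ne' fun h0 => ?_
      simp [h0] at hv
    have h2 : 2 ≤ C v := by
      have : (1 : ℚ) < C v := by
        by_contra! hle
        nlinarith
      exact_mod_cast this
    rcases S.adj_root_or_exists_adj_two_mul hw.ne' with hr | ⟨u, huv, hu⟩
    · refine .of_move (pebblingMove_pebble hr h2) ⟨_, .refl, ?_⟩
      simp [pebble]
    · refine .of_move (pebblingMove_pebble huv h2) (ih _ ?_ _ ?_ rfl)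
      · have hs := sum_mul_pebble (fun _ => 1) huv.ne h2
        simp only [one_mul, mul_one] at hs
        rw [← hn]
        have : ((∑ x, pebble C v u x : ℕ) : ℚ) < ((∑ x, C x : ℕ) : ℚ) := by
          push_cast
          linarith
        exact_mod_cast this
      · unfold configWeight at hC ⊢
        rw [sum_mul_pebble S.w huv.ne h2, hu]
        linarith

theorem not_pebblingSolvable_of_le_one {G : SimpleGraph V} {r : V} {C : V → ℕ}
    (hC : ∀ v, C v ≤ 1) (hr : C r = 0) : ¬ PebblingSolvable G r C := by
  rintro ⟨D, hD, hDr⟩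
  rcases hD.cases_head with rfl | ⟨D', ⟨u, -, -, hu, -⟩, -⟩
  · omega
  · have := hC u
    omega

theorem exists_not_pebblingSolvable_of_lt_card [Fintype V] (G : SimpleGraph V) (r : V) {t : ℕ}
    (ht : t < Fintype.card V) : ∃ C : V → ℕ, ∑ v, C v = t ∧ ¬ PebblingSolvable G r C := by
  classical
  obtain ⟨s, hs, rfl⟩ : ∃ s ⊆ univ.erase r, #s = t := by
    refine exists_subset_card_eq ?_
    rw [card_erase_of_mem (mem_univ r), card_univ]
    omega
  refine ⟨fun v => if v ∈ s then 1 else 0, by simp, not_pebblingSolvable_of_le_one ?_ ?_⟩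
  · intro v
    split_ifs <;> omega
  · simp only [ite_eq_right_iff, one_ne_zero, imp_false]
    exact fun hrs => by simpa using hs hrs

/-- **Uniform Covering Lemma.** If a finite set `𝒯` of strategies rooted at `r`
has total weight `m > 0` at every vertex `v ≠ r`, then `π(G,r) = n(G)`. -/
theorem uniform_covering_lemma [Fintype V] (G : SimpleGraph V) (hG : G.Connected)
    (hV : 2 ≤ Fintype.card V) (r : V) (𝒯 : Finset (Strategy G r)) (m : ℚ) (hm : 0 < m)
    (h : ∀ v : V, v ≠ r → ∑ S ∈ 𝒯, S.w v = m) :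
    piVertex G r = Fintype.card V := by
  classical
  have hmem : ∀ C : V → ℕ, ∑ v, C v = Fintype.card V → PebblingSolvable G r C := by
    intro C hC
    by_contra hns
    have hr : C r = 0 := by
      by_contra h0
      exact hns ⟨C, .refl, Nat.one_le_iff_ne_zero.mpr h0⟩
    have hle : ∑ S ∈ 𝒯, configWeight S C ≤ ∑ S ∈ 𝒯, ∑ v, S.w v :=
      sum_le_sum fun S _ => not_lt.mp fun hlt => hns (S.pebblingSolvable_of_sum_lt C hlt)
    have hW : ∀ v, ∑ S ∈ 𝒯, S.w v = m - if v = r then m else 0 := by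
      intro v
      split_ifs with hv
      · simp [hv, Strategy.w_root]
      · simp [h v hv]
    have hleft : ∑ S ∈ 𝒯, configWeight S C = m * Fintype.card V := by
      simp only [configWeight]
      rw [sum_comm, ← hC]
      push_cast
      rw [mul_sum]
      refine sum_congr rfl fun v _ => ?_
      rw [← sum_mul, hW]
      split_ifs with hv
      · simp [hv, hr]
      · simp
    have hright : ∑ S ∈ 𝒯, ∑ v, S.w v = m * Fintype.card V - m := by
      rw [sum_comm]
      simp only [hW, sum_sub_distrib, sum_ite_eq', mem_univ, if_true, sum_const, card_univ,
        nsmul_eq_mul]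
      ring
    linarith
  refine le_antisymm (Nat.sInf_le hmem) (le_csInf ⟨_, hmem⟩ fun t ht => ?_)
  by_contra! hlt
  obtain ⟨C, hC, hns⟩ := exists_not_pebblingSolvable_of_lt_card G r hlt
  exact hns (ht C hC)
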